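/- Let L : ℝ^d → ℝ be strictly convex, differentiable, and of superlinear growth, and let (H_i, p_i) ∈ ℝ × ℝ^d, i = 1, …, k (k ≥ 1). Then there exists exactly one admissible vector v* ∈ ℝ^d, i.e. exactly one v* such that ∇L(v*) lies in the convex hull of {p_j : j ∈ I(v*)}; moreover this v* is the unique point of global minimum of L̂. -/

import Mathlib

open scoped RealInnerProductSpace

/-- `Lhat L H p v = max_i (L v + H i - ⟪p i, v⟫)`. -/
noncomputable def Lhat {d : ℕ} {ι : Type} [Fintype ι] [Nonempty ι]
    (L : EuclideanSpace ℝ (Fin d) → ℝ) (H : ι → ℝ)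
    (p : ι → EuclideanSpace ℝ (Fin d)) (v : EuclideanSpace ℝ (Fin d)) : ℝ :=
  Finset.univ.sup' Finset.univ_nonempty fun i => L v + H i - ⟪p i, v⟫

/-- `v` is admissible if `∇L(v)` lies in the convex hull of the active momenta
`{p j : j ∈ I(v)}`, where `I(v)` is the set of indices attaining the max in `Lhat`. -/
def Admissible {d : ℕ} {ι : Type} [Fintype ι] [Nonempty ι]
    (L : EuclideanSpace ℝ (Fin d) → ℝ) (H : ι → ℝ)
    (p : ι → EuclideanSpace ℝ (Fin d)) (v : EuclideanSpace ℝ (Fin d)) : Prop :=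
  gradient L v ∈ convexHull ℝ (p '' {j | L v + H j - ⟪p j, v⟫ = Lhat L H p v})

open Filter Topology

section InnerProduct

variable {E : Type*} [NormedAddCommGroup E] [InnerProductSpace ℝ E]

/-- Some generator of a convex hull lies in any closed half-space bounded by a hyperplane through
a point of the hull. -/
theorem exists_inner_le_of_mem_convexHull {s : Set E} {g : E} (hg : g ∈ convexHull ℝ s) (u : E) :
    ∃ x ∈ s, ⟪x, u⟫ ≤ ⟪g, u⟫ := by
  by_contra! h
  have hsub : convexHull ℝ s ⊆ {x | ⟪g, u⟫ < ⟪x, u⟫} :=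
    convexHull_min h (convex_halfSpace_gt
      ⟨fun x y => inner_add_left x y u, fun c x => real_inner_smul_left x u c⟩ _)
  exact lt_irrefl ⟪g, u⟫ (hsub hg)

variable [CompleteSpace E]

theorem DifferentiableAt.hasDerivAt_comp_ray {f : E → ℝ} {v : E} (hf : DifferentiableAt ℝ f v)
    (u : E) : HasDerivAt (fun t : ℝ => f (v + t • u)) ⟪gradient f v, u⟫ 0 := by
  have hline : HasDerivAt (fun t : ℝ => v + t • u) u 0 := by
    simpa using ((hasDerivAt_id (0 : ℝ)).smul_const u).const_add v
  have hf' : HasFDerivAt f (InnerProductSpace.toDual ℝ E (gradient f v)) (v + (0 : ℝ) • u) := by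
    simpa using hf.hasGradientAt.hasFDerivAt
  exact hf'.comp_hasDerivAt 0 hline

theorem ConvexOn.add_inner_gradient_le {f : E → ℝ} (hconv : ConvexOn ℝ Set.univ f) {v : E}
    (hf : DifferentiableAt ℝ f v) (w : E) : f v + ⟪gradient f v, w - v⟫ ≤ f w := by
  have hφ : ConvexOn ℝ Set.univ (fun t : ℝ => f (v + t • (w - v))) := by
    simpa [Function.comp_def, AffineMap.lineMap_apply, add_comm] using
      hconv.comp_affineMap (AffineMap.lineMap v w : ℝ →ᵃ[ℝ] E)
  have h := hφ.le_slope_of_hasDerivAt (Set.mem_univ 0) (Set.mem_univ 1) one_pos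
    (hf.hasDerivAt_comp_ray (w - v))
  simp only [slope_def_field, one_smul, zero_smul, add_zero, add_sub_cancel, sub_zero, div_one] at h
  linarith

theorem StrictConvexOn.add_inner_gradient_lt {f : E → ℝ} (hconv : StrictConvexOn ℝ Set.univ f)
    {v w : E} (hf : DifferentiableAt ℝ f v) (hvw : v ≠ w) :
    f v + ⟪gradient f v, w - v⟫ < f w := by
  have hle := hconv.convexOn.add_inner_gradient_le hf ((1 / 2 : ℝ) • v + (1 / 2 : ℝ) • w)
  have hlt := hconv.2 (Set.mem_univ v) (Set.mem_univ w) hvw (one_half_pos (α := ℝ)) one_half_pos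
    (add_halves 1)
  have hmid : (1 / 2 : ℝ) • v + (1 / 2 : ℝ) • w - v = (1 / 2 : ℝ) • (w - v) := by module
  rw [hmid, inner_smul_right] at hle
  simp only [smul_eq_mul] at hlt
  linarith

theorem exists_inner_lt_of_notMem_convexHull {s : Set E} (hs : s.Finite) {g : E}
    (hg : g ∉ convexHull ℝ s) : ∃ u : E, ∀ x ∈ s, ⟪g, u⟫ < ⟪x, u⟫ := by
  obtain ⟨f, c, hfg, hfs⟩ := geometric_hahn_banach_point_closed (E := E) (convex_convexHull ℝ s)
    (hs.isClosed_convexHull ℝ) hg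
  refine ⟨(InnerProductSpace.toDual ℝ E).symm f, fun x hx => ?_⟩
  rw [real_inner_comm, real_inner_comm _ x, InnerProductSpace.toDual_symm_apply,
    InnerProductSpace.toDual_symm_apply]
  exact hfg.trans (hfs x (subset_convexHull ℝ s hx))

end InnerProduct

theorem HasDerivAt.eventually_lt_of_neg {f : ℝ → ℝ} {f' x : ℝ} (hf : HasDerivAt f f' x)
    (hf' : f' < 0) : ∀ᶠ t in 𝓝[>] x, f t < f x := by
  have h := (hasDerivWithinAt_iff_tendsto_slope' (lt_irrefl x)).mp
    (hf.hasDerivWithinAt (s := Set.Ioi x))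
  filter_upwards [h.eventually_lt_const hf', self_mem_nhdsWithin] with t ht hxt
  rw [slope_def_field, div_neg_iff] at ht
  have := sub_pos.mpr (Set.mem_Ioi.mp hxt)
  rcases ht with ht | ht <;> linarith

section Lhat

variable {d : ℕ} {ι : Type} [Fintype ι] [Nonempty ι] {L : EuclideanSpace ℝ (Fin d) → ℝ}
  {H : ι → ℝ} {p : ι → EuclideanSpace ℝ (Fin d)}

theorem le_Lhat (i : ι) (v : EuclideanSpace ℝ (Fin d)) :
    L v + H i - ⟪p i, v⟫ ≤ Lhat L H p v :=
  Finset.le_sup' (fun i => L v + H i - ⟪p i, v⟫) (Finset.mem_univ i)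

theorem continuous_Lhat (hL : Continuous L) : Continuous (Lhat L H p) := by
  unfold Lhat
  exact Continuous.finset_sup'_apply _ fun i _ => by fun_prop

theorem tendsto_Lhat_cobounded
    (hsuper : Tendsto (fun v : EuclideanSpace ℝ (Fin d) => L v / ‖v‖)
      (Bornology.cobounded _) atTop) :
    Tendsto (Lhat L H p) (Bornology.cobounded _) atTop := by
  obtain ⟨i⟩ := ‹Nonempty ι›
  refine tendsto_atTop_mono' _ ?_
    (tendsto_atTop_add_const_right _ (H i) tendsto_norm_cobounded_atTop)
  filter_upwards [hsuper.eventually_ge_atTop (‖p i‖ + 1),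
    tendsto_norm_cobounded_atTop.eventually_gt_atTop 0] with v hv hpos
  rw [le_div_iff₀ hpos] at hv
  have hle := le_Lhat (L := L) (H := H) (p := p) i v
  have hin := real_inner_le_norm (p i) v
  linarith

theorem Admissible.Lhat_lt {v w : EuclideanSpace ℝ (Fin d)} (hv : Admissible L H p v)
    (hconv : StrictConvexOn ℝ Set.univ L) (hdiff : DifferentiableAt ℝ L v) (hvw : v ≠ w) :
    Lhat L H p v < Lhat L H p w := by
  obtain ⟨_, ⟨j, hj, rfl⟩, hle⟩ := exists_inner_le_of_mem_convexHull hv (w - v)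
  have hj : L v + H j - ⟪p j, v⟫ = Lhat L H p v := hj
  have hlt := hconv.add_inner_gradient_lt hdiff hvw
  have hw := le_Lhat (L := L) (H := H) (p := p) j w
  rw [inner_sub_right (p j)] at hle
  linarith

theorem admissible_of_forall_Lhat_le {v : EuclideanSpace ℝ (Fin d)} (hcont : Continuous L)
    (hdiff : DifferentiableAt ℝ L v) (hmin : ∀ w, Lhat L H p v ≤ Lhat L H p w) :
    Admissible L H p v := by
  by_contra hv
  obtain ⟨u, hu⟩ := exists_inner_lt_of_notMem_convexHull ((Set.toFinite _).image p) hv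
  have hdecr : ∀ j, ∀ᶠ t : ℝ in 𝓝[>] 0,
      L (v + t • u) + H j - ⟪p j, v + t • u⟫ < Lhat L H p v := by
    intro j
    rcases (le_Lhat (L := L) (H := H) (p := p) j v).eq_or_lt with hj | hj
    · have hinner : HasDerivAt (fun t : ℝ => ⟪p j, v + t • u⟫) ⟪p j, u⟫ 0 := by
        simpa [inner_add_right, inner_smul_right] using
          ((hasDerivAt_id (0 : ℝ)).mul_const ⟪p j, u⟫).const_add ⟪p j, v⟫
      have hlt := (((hdiff.hasDerivAt_comp_ray u).add_const (H j)).sub hinner).eventually_lt_of_neg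
        (sub_neg.mpr (hu _ (Set.mem_image_of_mem p hj)))
      filter_upwards [hlt] with t ht
      simpa [hj] using ht
    · have hc : Continuous fun t : ℝ => L (v + t • u) + H j - ⟪p j, v + t • u⟫ := by fun_prop
      refine (hc.continuousAt.eventually_lt_const ?_).filter_mono nhdsWithin_le_nhds
      simpa using hj
  obtain ⟨t, ht⟩ := (eventually_all.mpr hdecr).exists
  exact (hmin (v + t • u)).not_gt ((Finset.sup'_lt_iff _).mpr fun j _ => ht j)

end Lhat

/-- Uniqueness Lemma: there is exactly one admissible velocity `v*`,
and it is the unique point of global minimum of `L̂`. -/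
theorem exists_unique_admissible {d : ℕ} (hd : 1 ≤ d) {ι : Type} [Fintype ι] [Nonempty ι]
    (L : EuclideanSpace ℝ (Fin d) → ℝ)
    (hconv : StrictConvexOn ℝ Set.univ L)
    (hdiff : Differentiable ℝ L)
    (hsuper : Filter.Tendsto (fun (v : EuclideanSpace ℝ (Fin d)) => L v / ‖v‖)
      (Filter.comap (fun (v : EuclideanSpace ℝ (Fin d)) => ‖v‖) Filter.atTop) Filter.atTop)
    (H : ι → ℝ) (p : ι → EuclideanSpace ℝ (Fin d)) :
    ∃ vstar : EuclideanSpace ℝ (Fin d),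
      Admissible L H p vstar ∧
      (∀ v, Admissible L H p v → v = vstar) ∧
      (∀ v, v ≠ vstar → Lhat L H p vstar < Lhat L H p v) := by
  obtain ⟨v, hmin⟩ := (continuous_Lhat (H := H) (p := p) hdiff.continuous).exists_forall_le
    (Metric.cobounded_eq_cocompact (α := EuclideanSpace ℝ (Fin d)) ▸
      tendsto_Lhat_cobounded (comap_norm_atTop (E := EuclideanSpace ℝ (Fin d)) ▸ hsuper))
  have hv := admissible_of_forall_Lhat_le hdiff.continuous (hdiff v) hmin
  refine ⟨v, hv, fun w hw => ?_, fun w hw => hv.Lhat_lt hconv (hdiff v) hw.symm⟩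
  by_contra hne
  exact (hmin w).not_gt (hw.Lhat_lt hconv (hdiff w) hne)
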